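/- (Proposition 2.1, energy part.) Let u : ℝ → (Fin N → ℝ) be such that for every t ∈ ℝ the ℂ^N-valued function t ↦ (u(t) : Fin N → ℂ) has derivative f_E(u(t)) = −B_{S1}(−B_{HS1}u(t) + (1/m)·u(t)^{∘m}) at t. Then the semi-discrete energy is conserved: E_h(u(t)) = E_h(u(0)) for all t ∈ ℝ, where E_h(w) := (1/2)·⟨B_{HS1}w, w⟩_h − (1/(m(m+1)))·⟨w^{∘m}, w⟩_h. -/

import Mathlib

open Matrix Complex BigOperators

noncomputable section

/-- The shifted integer index `k̂ = k - N/2` associated to `k ∈ Fin N`. -/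
def khat (N : ℕ) (k : Fin N) : ℤ := (k : ℤ) - (N : ℤ) / 2

/-- The collocation angles `θ_j = 2π ĵ / N`. -/
def theta (N : ℕ) (j : Fin N) : ℝ := 2 * Real.pi * (khat N j : ℝ) / N

/-- The discrete Fourier matrix `F`, `F_{k,j} = (1/N) exp(-i k̂ θ_j)`. -/
def Fm (N : ℕ) : Matrix (Fin N) (Fin N) ℂ :=
  Matrix.of fun k j => (N : ℂ)⁻¹ * Complex.exp (-Complex.I * (khat N k : ℂ) * (theta N j : ℂ))

/-- The inverse discrete Fourier matrix `G`, `G_{j,k} = exp(i k̂ θ_j)`. -/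
def Gm (N : ℕ) : Matrix (Fin N) (Fin N) ℂ :=
  Matrix.of fun j k => Complex.exp (Complex.I * (khat N k : ℂ) * (theta N j : ℂ))

/-- The diagonal weight matrix `P = diag(α - i x_j)`. -/
def Pm (N : ℕ) (α : ℝ) (x : Fin N → ℝ) : Matrix (Fin N) (Fin N) ℂ :=
  Matrix.diagonal fun j => (α : ℂ) - Complex.I * (x j : ℂ)

/-- The diagonal matrix `P⁻¹ = diag((α - i x_j)⁻¹)`. -/
def PinvM (N : ℕ) (α : ℝ) (x : Fin N → ℝ) : Matrix (Fin N) (Fin N) ℂ :=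
  Matrix.diagonal fun j => ((α : ℂ) - Complex.I * (x j : ℂ))⁻¹

/-- The diagonal matrix `P̄ = diag(α + i x_j)`. -/
def PbarM (N : ℕ) (α : ℝ) (x : Fin N → ℝ) : Matrix (Fin N) (Fin N) ℂ :=
  Matrix.diagonal fun j => (α : ℂ) + Complex.I * (x j : ℂ)

/-- The discrete Hilbert transform matrix `H = diag(-i sgn(k̂))` with `sgn(0) = 1`. -/
def Hm (N : ℕ) : Matrix (Fin N) (Fin N) ℂ :=
  Matrix.diagonal fun k => if 0 ≤ khat N k then -Complex.I else Complex.I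

/-- The tridiagonal differentiation matrix `S1`:
`(S1)_{k,k-1} = i k̂/(2α)`, `(S1)_{k,k} = i (2k̂+1)/(2α)`, `(S1)_{k,k+1} = i (k̂+1)/(2α)`. -/
def S1 (N : ℕ) (α : ℝ) : Matrix (Fin N) (Fin N) ℂ :=
  Matrix.of fun k l =>
    if (l : ℤ) = (k : ℤ) - 1 then Complex.I * (khat N k : ℂ) / (2 * (α : ℂ))
    else if (l : ℤ) = (k : ℤ) then Complex.I * (2 * (khat N k : ℂ) + 1) / (2 * (α : ℂ))
    else if (l : ℤ) = (k : ℤ) + 1 then Complex.I * ((khat N k : ℂ) + 1) / (2 * (α : ℂ))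
    else 0

/-- The second-derivative matrix `S2 = S1 · S1`. -/
def S2 (N : ℕ) (α : ℝ) : Matrix (Fin N) (Fin N) ℂ := S1 N α * S1 N α

/-- The discrete inner product `⟨u,v⟩_h = (π/(Nα)) Σ_j (α² + x_j²) u_j conj(v_j)`. -/
def iph (N : ℕ) (α : ℝ) (x : Fin N → ℝ) (u v : Fin N → ℂ) : ℂ :=
  ((Real.pi / (N * α) : ℝ) : ℂ) *
    ∑ j, ((α ^ 2 + x j ^ 2 : ℝ) : ℂ) * u j * (starRingEnd ℂ) (v j)

/-- The conjugated first-derivative operator `B_{S1} = P⁻¹ G S1 F P`. -/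
def BS1 (N : ℕ) (α : ℝ) (x : Fin N → ℝ) : Matrix (Fin N) (Fin N) ℂ :=
  PinvM N α x * Gm N * S1 N α * Fm N * Pm N α x

/-- The conjugated operator `B_{HS1} = P⁻¹ G H S1 F P`. -/
def BHS1 (N : ℕ) (α : ℝ) (x : Fin N → ℝ) : Matrix (Fin N) (Fin N) ℂ :=
  PinvM N α x * Gm N * Hm N * S1 N α * Fm N * Pm N α x

/-- The conjugated dispersion operator `B_{HS2} = P⁻¹ G H S2 F P`. -/
def BHS2 (N : ℕ) (α : ℝ) (x : Fin N → ℝ) : Matrix (Fin N) (Fin N) ℂ :=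
  PinvM N α x * Gm N * Hm N * S2 N α * Fm N * Pm N α x

/-- Coercion of a real vector into a complex vector. -/
def cv (N : ℕ) (u : Fin N → ℝ) : Fin N → ℂ := fun j => (u j : ℂ)

/-- Entrywise `m`-th power of a complex vector. -/
def pw (N : ℕ) (m : ℕ) (u : Fin N → ℂ) : Fin N → ℂ := fun j => u j ^ m

/-- The mass-conservative semi-discrete right-hand side
`f_M(w) = B_{HS2} w - (1/(m+1)) (w^{∘(m-1)} ⊙ (B_{S1} w) + B_{S1}(w^{∘m}))`. -/
def fM (N : ℕ) (α : ℝ) (x : Fin N → ℝ) (m : ℕ) (w : Fin N → ℂ) : Fin N → ℂ :=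
  fun j => (BHS2 N α x *ᵥ w) j
    - (1 / ((m : ℂ) + 1)) *
        ((w j) ^ (m - 1) * (BS1 N α x *ᵥ w) j + (BS1 N α x *ᵥ pw N m w) j)

/-- The energy-conservative semi-discrete right-hand side
`f_E(w) = -B_{S1}(-B_{HS1} w + (1/m) w^{∘m})`. -/
def fE (N : ℕ) (α : ℝ) (x : Fin N → ℝ) (m : ℕ) (w : Fin N → ℂ) : Fin N → ℂ :=
  -(BS1 N α x *ᵥ (-(BHS1 N α x *ᵥ w) + (1 / (m : ℂ)) • pw N m w))

/-- The semi-discrete energy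
`E_h(w) = (1/2)⟨B_{HS1} w, w⟩_h - (1/(m(m+1)))⟨w^{∘m}, w⟩_h`. -/
def Eh (N : ℕ) (α : ℝ) (x : Fin N → ℝ) (m : ℕ) (w : Fin N → ℂ) : ℂ :=
  (1 / 2 : ℂ) * iph N α x (BHS1 N α x *ᵥ w) w
    - (1 / ((m : ℂ) * ((m : ℂ) + 1))) * iph N α x (pw N m w) w

end

section InnerProduct

variable {N : ℕ} {α : ℝ} {x : Fin N → ℝ}

theorem iph_add_left (u v w : Fin N → ℂ) :
    iph N α x (u + v) w = iph N α x u w + iph N α x v w := by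
  simp only [iph, Pi.add_apply, mul_add, add_mul, Finset.sum_add_distrib]

theorem iph_smul_left (c : ℂ) (u v : Fin N → ℂ) :
    iph N α x (c • u) v = c * iph N α x u v := by
  simp only [iph, Pi.smul_apply, smul_eq_mul, Finset.mul_sum]
  exact Finset.sum_congr rfl fun j _ => by ring

theorem iph_neg_left (u v : Fin N → ℂ) : iph N α x (-u) v = -iph N α x u v := by
  simpa using iph_smul_left (α := α) (x := x) (-1) u v

theorem iph_conj_symm (u v : Fin N → ℂ) :
    (starRingEnd ℂ) (iph N α x v u) = iph N α x u v := by
  simp only [iph, map_mul, map_sum, Complex.conj_ofReal, Complex.conj_conj]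
  congr 1
  exact Finset.sum_congr rfl fun j _ => by ring

theorem iph_eq_dotProduct (u v : Fin N → ℂ) :
    iph N α x u v = ((Real.pi / (N * α) : ℝ) : ℂ) *
      (star v ⬝ᵥ (((Pm N α x)ᴴ * Pm N α x) *ᵥ u)) := by
  simp only [iph, Pm, diagonal_conjTranspose, diagonal_mul_diagonal, dotProduct, mulVec_diagonal]
  congr 1
  refine Finset.sum_congr rfl fun j _ => ?_
  simp only [Pi.star_apply, star_sub, star_mul', RCLike.star_def, Complex.conj_ofReal,
    Complex.conj_I, Complex.ofReal_add, Complex.ofReal_pow]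
  linear_combination ((x j : ℂ) ^ 2 * u j * (starRingEnd ℂ) (v j)) * Complex.I_sq

/-- The two arguments of the discrete inner product are differentiated by the product rule. -/
theorem HasDerivAt.iph {a b : ℝ → Fin N → ℂ} {a' b' : Fin N → ℂ} {t : ℝ}
    (ha : HasDerivAt a a' t) (hb : HasDerivAt b b' t) :
    HasDerivAt (fun s => iph N α x (a s) (b s))
      (_root_.iph N α x a' (b t) + _root_.iph N α x (a t) b') t := by
  rw [hasDerivAt_pi] at ha hb
  have h := (HasDerivAt.fun_sum (u := Finset.univ) fun j _ =>
    ((ha j).const_mul (((α ^ 2 + x j ^ 2 : ℝ) : ℂ))).mul (hb j).star).const_mul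
      ((Real.pi / (N * α) : ℝ) : ℂ)
  simp only [Finset.sum_add_distrib, mul_add] at h
  exact h

end InnerProduct

theorem HasDerivAt.matrix_mulVec {ι : Type*} [Fintype ι] (A : Matrix ι ι ℂ) {a : ℝ → ι → ℂ}
    {a' : ι → ℂ} {t : ℝ} (ha : HasDerivAt a a' t) :
    HasDerivAt (fun s => A *ᵥ a s) (A *ᵥ a') t := by
  rw [hasDerivAt_pi] at ha ⊢
  intro i
  exact HasDerivAt.fun_sum fun j _ => (ha j).const_mul (A i j)

theorem HasDerivAt.conj_eq_of_ofReal {f : ℝ → ℝ} {f' : ℂ} {t : ℝ}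
    (h : HasDerivAt (fun s => (f s : ℂ)) f' t) : (starRingEnd ℂ) f' = f' := by
  have h' := h.star
  simp only [RCLike.star_def, Complex.conj_ofReal] at h'
  exact h'.unique h

theorem Gm_eq_smul_conjTranspose {N : ℕ} (hN : 0 < N) : Gm N = (N : ℂ) • (Fm N)ᴴ := by
  ext j k
  have hN' : (N : ℂ) ≠ 0 := by exact_mod_cast hN.ne'
  simp only [Gm, Fm, of_apply, Matrix.smul_apply, conjTranspose_apply, smul_eq_mul, star_mul',
    RCLike.star_def, map_inv₀, map_natCast, ← Complex.exp_conj, map_mul, map_neg, Complex.conj_I,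
    Complex.conj_ofReal, map_intCast, neg_neg]
  rw [mul_inv_cancel_left₀ hN']

theorem Pm_mul_PinvM {N : ℕ} {α : ℝ} (hα : 0 < α) (x : Fin N → ℝ) :
    Pm N α x * PinvM N α x = 1 := by
  rw [Pm, PinvM, diagonal_mul_diagonal, ← diagonal_one]
  congr 1
  ext j
  refine mul_inv_cancel₀ fun h => hα.ne' ?_
  simpa using congrArg Complex.re h

/-- Adjoint of a Fourier multiplier conjugated by the weight `P`. -/
theorem iph_conjugated_mulVec {N : ℕ} (hN : 0 < N) {α : ℝ} (hα : 0 < α) (x : Fin N → ℝ)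
    (M : Matrix (Fin N) (Fin N) ℂ) (u v : Fin N → ℂ) :
    iph N α x ((PinvM N α x * Gm N * M * Fm N * Pm N α x) *ᵥ u) v =
      iph N α x u ((PinvM N α x * Gm N * Mᴴ * Fm N * Pm N α x) *ᵥ v) := by
  have key (L : Matrix (Fin N) (Fin N) ℂ) :
      ((Pm N α x)ᴴ * Pm N α x) * (PinvM N α x * Gm N * L * Fm N * Pm N α x) =
        (N : ℂ) • ((Fm N * Pm N α x)ᴴ * L * (Fm N * Pm N α x)) := by
    calc _ = (Pm N α x)ᴴ * (Pm N α x * PinvM N α x) * Gm N * L * Fm N * Pm N α x := by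
          simp only [Matrix.mul_assoc]
      _ = _ := by
          rw [Pm_mul_PinvM hα, Gm_eq_smul_conjTranspose hN, conjTranspose_mul]
          simp only [Matrix.mul_one, Matrix.mul_smul, Matrix.smul_mul, Matrix.mul_assoc]
  rw [← iph_conj_symm u, iph_eq_dotProduct, iph_eq_dotProduct, mulVec_mulVec, mulVec_mulVec,
    key, key, map_mul, Complex.conj_ofReal]
  congr 1
  rw [← RCLike.star_def, star_dotProduct, star_mulVec, ← dotProduct_mulVec]
  simp [conjTranspose_mul, Matrix.mul_assoc]

theorem S1_conjTranspose (N : ℕ) (α : ℝ) : (S1 N α)ᴴ = -S1 N α := by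
  ext k l
  simp only [conjTranspose_apply, S1, of_apply, Matrix.neg_apply, khat]
  split_ifs <;> first | omega | skip
  · have h : (l : ℤ) = k + 1 := by omega
    simp [h]
    ring
  · have h : (l : ℤ) = k := by omega
    simp [h]
    ring
  · have h : (k : ℤ) = l + 1 := by omega
    simp [h]
    ring
  · simp

theorem Hm_conjTranspose (N : ℕ) : (Hm N)ᴴ = -Hm N := by
  rw [Hm, diagonal_conjTranspose, diagonal_neg]
  congr 1
  ext k
  simp only [Pi.star_apply]
  split_ifs <;> simp

theorem Hm_mul_S1_comm (N : ℕ) (α : ℝ) : Hm N * S1 N α = S1 N α * Hm N := by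
  ext k l
  rw [Hm, diagonal_mul, mul_diagonal]
  by_cases hkl : (0 ≤ khat N k ↔ 0 ≤ khat N l)
  · simp only [hkl, mul_comm]
  · have hS : S1 N α k l = 0 := by
      simp only [S1, of_apply]
      unfold khat at hkl
      split_ifs
      · have : khat N k = 0 := by unfold khat; omega
        simp [this]
      · omega
      · have : khat N k = -1 := by unfold khat; omega
        simp [this]
      · rfl
    simp [hS]

theorem Hm_mul_S1_conjTranspose (N : ℕ) (α : ℝ) : (Hm N * S1 N α)ᴴ = Hm N * S1 N α := by
  rw [conjTranspose_mul, S1_conjTranspose, Hm_conjTranspose, neg_mul_neg, Hm_mul_S1_comm]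

theorem iph_BS1_mulVec {N : ℕ} (hN : 0 < N) {α : ℝ} (hα : 0 < α) (x : Fin N → ℝ)
    (u v : Fin N → ℂ) : iph N α x (BS1 N α x *ᵥ u) v = iph N α x u (-(BS1 N α x *ᵥ v)) := by
  rw [BS1, iph_conjugated_mulVec hN hα, S1_conjTranspose]
  simp [neg_mulVec]

theorem iph_BHS1_mulVec {N : ℕ} (hN : 0 < N) {α : ℝ} (hα : 0 < α) (x : Fin N → ℝ)
    (u v : Fin N → ℂ) : iph N α x (BHS1 N α x *ᵥ u) v = iph N α x u (BHS1 N α x *ᵥ v) := by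
  rw [BHS1, Matrix.mul_assoc _ (Hm N), iph_conjugated_mulVec hN hα, Hm_mul_S1_conjTranspose]

/-- Proposition 2.1 (energy part): any real solution of the semi-discrete system
`u_t = f_E(u) = -B_{S1}(-B_{HS1} u + (1/m) u^{∘m})` conserves the semi-discrete
energy `E_h`. -/
theorem semidiscrete_energy_conservation (N : ℕ) (hN : Even N) (hN0 : 0 < N)
    (α : ℝ) (hα : 0 < α) (x : Fin N → ℝ) (m : ℕ) (hm : 1 ≤ m)
    (u : ℝ → Fin N → ℝ)
    (hu : ∀ t : ℝ, HasDerivAt (fun s => cv N (u s)) (fE N α x m (cv N (u t))) t) :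
    ∀ t : ℝ, Eh N α x m (cv N (u t)) = Eh N α x m (cv N (u 0)) := by
  suffices h : ∀ t, HasDerivAt (fun s => Eh N α x m (cv N (u s))) 0 t from fun t =>
    is_const_of_deriv_eq_zero (fun s => (h s).differentiableAt) (fun s => (h s).deriv) t 0
  intro t
  set w := cv N (u t) with hw
  set v := fE N α x m w with hv
  have hm0 : (m : ℂ) ≠ 0 := by exact_mod_cast (by omega : m ≠ 0)
  have hm1 : (m : ℂ) + 1 ≠ 0 := by exact_mod_cast m.succ_ne_zero
  have v_real (j) : (starRingEnd ℂ) (v j) = v j :=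
    HasDerivAt.conj_eq_of_ofReal (hasDerivAt_pi.1 (hu t) j)
  have w_real (j) : (starRingEnd ℂ) (w j) = w j := Complex.conj_ofReal _
  have hpw : HasDerivAt (fun s => pw N m (cv N (u s)))
      (fun j => (m : ℂ) * w j ^ (m - 1) * v j) t :=
    hasDerivAt_pi.2 fun j => (hasDerivAt_pi.1 (hu t) j).pow m
  have power_deriv : iph N α x (fun j => (m : ℂ) * w j ^ (m - 1) * v j) w =
      m * iph N α x (pw N m w) v := by
    rw [← iph_smul_left]
    simp only [iph, pw, Pi.smul_apply, smul_eq_mul, v_real, w_real]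
    congr 1
    refine Finset.sum_congr rfl fun j _ => ?_
    rw [← pow_sub_one_mul (by omega : m ≠ 0) (w j)]
    ring
  have power_symm : iph N α x v (pw N m w) = iph N α x (pw N m w) v := by
    simp only [iph, pw, map_pow, v_real, w_real]
    congr 1
    exact Finset.sum_congr rfl fun j _ => by ring
  set q := -(BHS1 N α x *ᵥ w) + (1 / (m : ℂ)) • pw N m w with hq
  have hvq : v = -(BS1 N α x *ᵥ q) := rfl
  have skew : iph N α x v q + iph N α x q v = 0 := by
    rw [hvq, iph_neg_left, iph_BS1_mulVec hN0 hα, neg_add_cancel]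
  have expand_left : iph N α x q v =
      -iph N α x (BHS1 N α x *ᵥ w) v + 1 / (m : ℂ) * iph N α x (pw N m w) v := by
    rw [hq, iph_add_left, iph_neg_left, iph_smul_left]
  have expand_right : iph N α x v q =
      -iph N α x (BHS1 N α x *ᵥ v) w + 1 / (m : ℂ) * iph N α x (pw N m w) v := by
    rw [← iph_conj_symm, expand_left, map_add, map_neg, map_mul, iph_conj_symm, iph_conj_symm,
      power_symm, iph_BHS1_mulVec hN0 hα]
    simp
  have hE := (((hu t).matrix_mulVec (BHS1 N α x)).iph (α := α) (x := x) (hu t)).const_mul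
    (1 / 2 : ℂ) |>.sub
      ((hpw.iph (α := α) (x := x) (hu t)).const_mul (1 / ((m : ℂ) * ((m : ℂ) + 1))))
  refine hE.congr_deriv ?_
  rw [← hw, ← hv, power_deriv]
  rw [expand_left, expand_right] at skew
  have power_coeff (c : ℂ) : 1 / ((m : ℂ) * (m + 1)) * (m * c + c) = 1 / m * c := by
    field_simp
  rw [power_coeff]
  linear_combination (-1 / 2 : ℂ) * skew
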